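/- The multipartite entanglement of purification is bounded below by the multipartite mutual information: Δ_P(A₁:⋯:Aₙ) ≥ I(A₁:⋯:Aₙ) for any n-partite state. -/

import Mathlib

open scoped BigOperators ComplexOrder

noncomputable section

/-- Von Neumann entropy of a matrix: `−∑ λᵢ log λᵢ` over its eigenvalues
(defined to be `0` if the matrix is not Hermitian). -/
noncomputable def matEntropy {ι : Type} [Fintype ι] [DecidableEq ι]
    (ρ : Matrix ι ι ℂ) : ℝ :=
  if h : ρ.IsHermitian then ∑ i, Real.negMulLog (h.eigenvalues i) else 0

/-- A density matrix: positive semidefinite with unit trace. -/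
def IsDensityMatrix {ι : Type} [Fintype ι] (ρ : Matrix ι ι ℂ) : Prop :=
  ρ.PosSemidef ∧ ρ.trace = 1

instance sumElimFintype {κ π : Type} {α : κ → Type} {δ : π → Type}
    [∀ i, Fintype (α i)] [∀ k, Fintype (δ k)] :
    ∀ i : κ ⊕ π, Fintype (Sum.elim α δ i)
  | .inl a => inferInstanceAs (Fintype (α a))
  | .inr b => inferInstanceAs (Fintype (δ b))

instance sumElimDecEq {κ π : Type} {α : κ → Type} {δ : π → Type}
    [∀ i, DecidableEq (α i)] [∀ k, DecidableEq (δ k)] :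
    ∀ i : κ ⊕ π, DecidableEq (Sum.elim α δ i)
  | .inl a => inferInstanceAs (DecidableEq (α a))
  | .inr b => inferInstanceAs (DecidableEq (δ b))

/-- Reduced density matrix on the subsystems in `s` (partial trace over the rest). -/
noncomputable def reduce {κ : Type} [Fintype κ] [DecidableEq κ] {α : κ → Type}
    [∀ i, Fintype (α i)] (s : Finset κ)
    (ρ : Matrix (∀ i, α i) (∀ i, α i) ℂ) :
    Matrix (∀ i : {j // j ∈ s}, α i.1) (∀ i : {j // j ∈ s}, α i.1) ℂ :=
  Matrix.of fun f g => ∑ h : ∀ i : {j // j ∉ s}, α i.1,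
    ρ (fun i => if hi : i ∈ s then f ⟨i, hi⟩ else h ⟨i, hi⟩)
      (fun i => if hi : i ∈ s then g ⟨i, hi⟩ else h ⟨i, hi⟩)

/-- The (pure) density matrix `|ψ⟩⟨ψ|` of a state vector. -/
def vecState {ι : Type} (ψ : ι → ℂ) : Matrix ι ι ℂ :=
  Matrix.of fun x y => ψ x * star (ψ y)

/-- Multipartite mutual information `∑ᵢ S_{Aᵢ} − S_{A₁⋯Aₙ}`. -/
noncomputable def Imulti {κ : Type} [Fintype κ] [DecidableEq κ] {α : κ → Type}
    [∀ i, Fintype (α i)] [∀ i, DecidableEq (α i)]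
    (ρ : Matrix (∀ i, α i) (∀ i, α i) ℂ) : ℝ :=
  (∑ i, matEntropy (reduce {i} ρ)) - matEntropy ρ

/-- Merge an assignment on the original systems with one on the ancillas. -/
def mergeSum {κ π : Type} {α : κ → Type} {δ : π → Type}
    (f : ∀ i, α i) (h : ∀ k, δ k) : ∀ i : κ ⊕ π, Sum.elim α δ i
  | .inl a => f a
  | .inr b => h b

/-- The subsystems belonging to party `k` together with its ancilla. -/
def partyFinset {κ π : Type} [Fintype κ] [DecidableEq κ] [DecidableEq π]
    (p : κ → π) (k : π) : Finset (κ ⊕ π) :=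
  (Finset.univ.filter fun i => p i = k).image Sum.inl ∪ {Sum.inr k}

/-- `ψ` (on the original systems plus one ancilla `Fin (d k)` per party)
purifies `ρ`: tracing out all ancillas from `|ψ⟩⟨ψ|` gives back `ρ`. -/
def Purifies {κ π : Type} [Fintype κ] {α : κ → Type} [∀ i, Fintype (α i)]
    [Fintype π] [DecidableEq π] {d : π → ℕ}
    (ψ : (∀ i : κ ⊕ π, Sum.elim α (fun k => Fin (d k)) i) → ℂ)
    (ρ : Matrix (∀ i, α i) (∀ i, α i) ℂ) : Prop :=
  ∀ f g, (∑ h : ∀ k, Fin (d k), vecState ψ (mergeSum f h) (mergeSum g h)) = ρ f g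

/-- Multipartite entanglement of purification for the partition of the systems `κ`
into parties `π` given by `p`: the infimum over all purifications (with one ancilla
per party, of arbitrary finite dimension) of `∑ₖ S_{AₖAₖ'}`. -/
noncomputable def DeltaPart {κ π : Type} [Fintype κ] [DecidableEq κ]
    [Fintype π] [DecidableEq π] {α : κ → Type}
    [∀ i, Fintype (α i)] [∀ i, DecidableEq (α i)]
    (p : κ → π) (ρ : Matrix (∀ i, α i) (∀ i, α i) ℂ) : ℝ :=
  sInf { x | ∃ (d : π → ℕ) (ψ : (∀ i : κ ⊕ π, Sum.elim α (fun k => Fin (d k)) i) → ℂ),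
    Purifies ψ ρ ∧
    x = ∑ k : π, matEntropy (reduce (partyFinset p k) (vecState ψ)) }

/-- Bipartite-style entanglement of purification for the partition `p`:
the infimum over purifications of the entropy of the single party `k₀`
together with its ancilla. -/
noncomputable def EPart {κ π : Type} [Fintype κ] [DecidableEq κ]
    [Fintype π] [DecidableEq π] {α : κ → Type}
    [∀ i, Fintype (α i)] [∀ i, DecidableEq (α i)]
    (p : κ → π) (k₀ : π) (ρ : Matrix (∀ i, α i) (∀ i, α i) ℂ) : ℝ :=
  sInf { x | ∃ (d : π → ℕ) (ψ : (∀ i : κ ⊕ π, Sum.elim α (fun k => Fin (d k)) i) → ℂ),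
    Purifies ψ ρ ∧
    x = matEntropy (reduce (partyFinset p k₀) (vecState ψ)) }

open Filter Topology in
theorem tendsto_sum_mul_log_sub {ι : Type*} [Fintype ι] (w x : ι → ℝ) (hx : ∀ i, 0 ≤ x i) :
    Tendsto (fun t => ∑ i, w i * Real.log (x i + t) - (∑ i, w i) * Real.log t) atTop (𝓝 0) := by
  have h1 : Tendsto (fun t : ℝ => ∑ i, w i * Real.log (x i / t + 1)) atTop (𝓝 0) := by
    have h2 : ∀ i ∈ (Finset.univ : Finset ι),
        Tendsto (fun t : ℝ => w i * Real.log (x i / t + 1)) atTop (𝓝 0) := by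
      intro i _
      have h3 : Tendsto (fun t : ℝ => x i / t + 1) atTop (𝓝 (0 + 1)) :=
        (tendsto_const_nhds.div_atTop tendsto_id).add tendsto_const_nhds
      simpa using (h3.log (by norm_num)).const_mul (w i)
    simpa using tendsto_finsetSum _ h2
  refine h1.congr' ?_
  filter_upwards [eventually_gt_atTop 0] with t ht
  rw [Finset.sum_mul, ← Finset.sum_sub_distrib]
  refine Finset.sum_congr rfl fun i _ => ?_
  have hpos : 0 < x i + t := by have := hx i; positivity
  rw [← mul_sub, ← Real.log_div hpos.ne' ht.ne']
  congr 2
  field_simp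

theorem continuousOn_sum_mul_log {ι : Type*} [Fintype ι] (w x : ι → ℝ) (hx : ∀ i, 0 ≤ x i)
    (hwx : ∀ i, x i = 0 → w i = 0) :
    ContinuousOn (fun t => ∑ i, w i * Real.log (x i + t)) (Set.Ici 0) := by
  refine continuousOn_finsetSum _ fun i _ => ?_
  rcases (hx i).eq_or_lt with h0 | h0
  · simp [hwx i h0.symm, continuousOn_const]
  · refine continuousOn_const.mul (ContinuousOn.log (by fun_prop) fun t ht => ?_)
    have : (0 : ℝ) ≤ t := ht
    positivity

theorem hasDerivAt_sum_mul_log {ι : Type*} [Fintype ι] (w x : ι → ℝ) (hx : ∀ i, 0 ≤ x i)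
    {t : ℝ} (ht : 0 < t) :
    HasDerivAt (fun t => ∑ i, w i * Real.log (x i + t)) (∑ i, w i / (x i + t)) t := by
  refine HasDerivAt.fun_sum fun i _ => ?_
  have hpos : x i + t ≠ 0 := by have := hx i; positivity
  simpa [div_eq_mul_inv] using (((hasDerivAt_id t).const_add (x i)).log hpos).const_mul (w i)

open Filter Topology in
/-- Comparison of logarithmic averages from a comparison of all resolvent averages. -/
theorem sum_mul_log_le_of_resolvent_le {ι κ : Type*} [Fintype ι] [Fintype κ]
    (w x : ι → ℝ) (v y : κ → ℝ) (hx : ∀ i, 0 ≤ x i) (hy : ∀ j, 0 ≤ y j)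
    (hwx : ∀ i, x i = 0 → w i = 0) (hvy : ∀ j, y j = 0 → v j = 0)
    (hsum : ∑ i, w i = ∑ j, v j)
    (h : ∀ t : ℝ, 0 < t → ∑ j, v j / (y j + t) ≤ ∑ i, w i / (x i + t)) :
    ∑ i, w i * Real.log (x i) ≤ ∑ j, v j * Real.log (y j) := by
  let G : ℝ → ℝ := fun t => ∑ i, w i * Real.log (x i + t) - ∑ j, v j * Real.log (y j + t)
  have hmono : MonotoneOn G (Set.Ici 0) := by
    have hG : ∀ t : ℝ, 0 < t →
        HasDerivAt G (∑ i, w i / (x i + t) - ∑ j, v j / (y j + t)) t := fun t ht =>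
      (hasDerivAt_sum_mul_log w x hx ht).sub (hasDerivAt_sum_mul_log v y hy ht)
    refine monotoneOn_of_deriv_nonneg (convex_Ici 0)
      ((continuousOn_sum_mul_log w x hx hwx).sub (continuousOn_sum_mul_log v y hy hvy)) ?_ ?_
    · intro t ht
      rw [interior_Ici] at ht
      exact (hG t ht).differentiableAt.differentiableWithinAt
    · intro t ht
      rw [interior_Ici] at ht
      rw [(hG t ht).deriv]
      exact sub_nonneg.2 (h t ht)
  have hlim : Tendsto G atTop (𝓝 0) := by
    have := (tendsto_sum_mul_log_sub w x hx).sub (tendsto_sum_mul_log_sub v y hy)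
    rw [hsum] at this
    simpa [G] using this
  have h0 : G 0 ≤ 0 := by
    refine ge_of_tendsto hlim ?_
    filter_upwards [eventually_ge_atTop 0] with t ht
    exact hmono Set.self_mem_Ici ht ht
  simpa [G] using h0

theorem Matrix.IsHermitian.matEntropy_eq {ι : Type} [Fintype ι] [DecidableEq ι]
    {M : Matrix ι ι ℂ} (h : M.IsHermitian) :
    matEntropy M = ∑ i, Real.negMulLog (h.eigenvalues i) := by
  rw [matEntropy, dif_pos h]

theorem Matrix.IsHermitian.matEntropy_eq_sum_roots {ι : Type} [Fintype ι] [DecidableEq ι]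
    {M : Matrix ι ι ℂ} (h : M.IsHermitian) :
    matEntropy M = (M.charpoly.roots.map fun z => Real.negMulLog z.re).sum := by
  rw [h.matEntropy_eq, h.roots_charpoly_eq_eigenvalues, Multiset.map_map]
  simp

/-- The von Neumann entropy does not depend on the labelling of the basis. -/
theorem Matrix.IsHermitian.matEntropy_reindex {ι κ : Type} [Fintype ι] [DecidableEq ι] [Fintype κ]
    [DecidableEq κ] {M : Matrix ι ι ℂ} (h : M.IsHermitian) (e : ι ≃ κ) :
    matEntropy (Matrix.reindex e e M) = matEntropy M := by
  have h' : (Matrix.reindex e e M).IsHermitian := h.submatrix _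
  rw [h'.matEntropy_eq_sum_roots, h.matEntropy_eq_sum_roots, Matrix.charpoly_reindex]

/-- Spectral decomposition in terms of the matrix of eigenvectors. -/
theorem Matrix.IsHermitian.eq_eigenvectorUnitary_mul {ι : Type*} [Fintype ι] [DecidableEq ι]
    {M : Matrix ι ι ℂ} (h : M.IsHermitian) :
    M = (h.eigenvectorUnitary : Matrix ι ι ℂ) *
      Matrix.diagonal (fun i => (h.eigenvalues i : ℂ)) *
      (h.eigenvectorUnitary : Matrix ι ι ℂ).conjTranspose := by
  conv_lhs => rw [h.spectral_theorem, Unitary.conjStarAlgAut_apply]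
  rfl

theorem Matrix.trace_conjTranspose_mul_self_eq_sum {ι κ : Type*} [Fintype ι] [Fintype κ]
    (X : Matrix ι κ ℂ) :
    (X.conjTranspose * X).trace = ((∑ j, ∑ i, ‖X i j‖ ^ 2 : ℝ) : ℂ) := by
  simp [Matrix.trace, Matrix.mul_apply, Complex.conj_mul']

theorem Matrix.trace_mul_diagonal {ι : Type*} [Fintype ι] [DecidableEq ι] (P : Matrix ι ι ℂ)
    (d : ι → ℂ) : (P * Matrix.diagonal d).trace = ∑ j, P j j * d j := by
  simp [Matrix.trace, Matrix.mul_diagonal]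

theorem Matrix.trace_conjTranspose_mul_self_mul_diagonal {ι κ : Type*} [Fintype ι] [Fintype κ]
    [DecidableEq κ] (X : Matrix ι κ ℂ) (r : κ → ℝ) :
    (X.conjTranspose * X * Matrix.diagonal (fun j => (r j : ℂ))).trace =
      ((∑ j, ∑ i, r j * ‖X i j‖ ^ 2 : ℝ) : ℂ) := by
  rw [Matrix.trace_mul_diagonal]
  simp [Matrix.mul_apply, Complex.mul_conj', Finset.mul_sum, mul_comm]

/-- Cauchy–Schwarz for the Hilbert–Schmidt inner product. -/
theorem Matrix.norm_trace_conjTranspose_mul_sq_le {ι κ : Type*} [Fintype ι] [Fintype κ]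
    (W M : Matrix ι κ ℂ) :
    ‖(W.conjTranspose * M).trace‖ ^ 2 ≤
      (∑ j, ∑ i, ‖W i j‖ ^ 2) * ∑ j, ∑ i, ‖M i j‖ ^ 2 := by
  have h1 : ‖(W.conjTranspose * M).trace‖ ≤ ∑ p : κ × ι, ‖W p.2 p.1‖ * ‖M p.2 p.1‖ := by
    rw [Fintype.sum_prod_type]
    simp only [Matrix.trace, Matrix.mul_apply, Matrix.diag_apply, Matrix.conjTranspose_apply]
    refine (norm_sum_le _ _).trans (Finset.sum_le_sum fun j _ => ?_)
    refine (norm_sum_le _ _).trans (Finset.sum_le_sum fun i _ => ?_)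
    simp
  refine (pow_le_pow_left₀ (norm_nonneg _) h1 2).trans ?_
  simpa only [Fintype.sum_prod_type] using Finset.sum_mul_sq_le_sq_mul_sq Finset.univ
    (fun p : κ × ι => ‖W p.2 p.1‖) (fun p => ‖M p.2 p.1‖)

open Matrix in
/-- Resolvent form of the monotonicity of the relative entropy under partial trace, for a pure
first argument `M` (viewed as a matrix) and a second argument with eigenvectors `V k` and
eigenvalues `s k`. -/
theorem resolvent_partialTrace_le {A B K : Type*} [Fintype A] [DecidableEq A] [Fintype B]
    [Fintype K] (V : K → Matrix A B ℂ) (M : Matrix A B ℂ) (s : K → ℝ) (s' r : A → ℝ)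
    (E F : Matrix A A ℂ) (hs : ∀ k, 0 ≤ s k)
    (hE : Eᴴ * E = 1) (hF : Fᴴ * F = 1)
    (hV : ∀ N N' : Matrix A B ℂ,
      ∑ k, star ((V k)ᴴ * N).trace * ((V k)ᴴ * N').trace = (Nᴴ * N').trace)
    (hσ : ∑ k, (s k : ℂ) • (V k * (V k)ᴴ) = E * diagonal (fun i => (s' i : ℂ)) * Eᴴ)
    (hρ : M * Mᴴ = F * diagonal (fun j => (r j : ℂ)) * Fᴴ) (hM : (M * Mᴴ).trace = 1)
    {t : ℝ} (ht : 0 < t) :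
    ∑ j, ∑ i, r j ^ 2 * ‖(Eᴴ * F) i j‖ ^ 2 / (s' i + t * r j) ≤
      ∑ k, ‖((V k)ᴴ * M).trace‖ ^ 2 / (s k + t) := by
  set G := Eᴴ * F with hG
  set Q := ∑ j, ∑ i, r j ^ 2 * ‖G i j‖ ^ 2 / (s' i + t * r j) with hQ
  let Y : Matrix A A ℂ := Matrix.of fun i j => ((r j / (s' i + t * r j) : ℝ) : ℂ) * G i j
  let X := E * Y * Fᴴ
  let N := X * M
  have hcross : (Nᴴ * M).trace = (Q : ℂ) := by
    calc (Nᴴ * M).trace = (Xᴴ * (M * Mᴴ)).trace := by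
          rw [conjTranspose_mul, Matrix.mul_assoc, trace_mul_comm, Matrix.mul_assoc]
      _ = (F * (Yᴴ * (Eᴴ * F) * diagonal (fun j => (r j : ℂ))) * Fᴴ).trace := by
          rw [hρ]; simp only [X, conjTranspose_mul, conjTranspose_conjTranspose, Matrix.mul_assoc]
      _ = (Yᴴ * G * diagonal (fun j => (r j : ℂ))).trace := by
          rw [trace_mul_comm, ← Matrix.mul_assoc, hF, Matrix.one_mul]
      _ = Q := by
          rw [hQ, trace_mul_diagonal]
          push_cast
          simp only [Matrix.mul_apply, Finset.sum_mul]
          refine Finset.sum_congr rfl fun j _ => Finset.sum_congr rfl fun i _ => ?_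
          rw [← Complex.conj_mul']
          simp [Y]
          ring
  have hnorm : (Nᴴ * N).trace = ((∑ j, ∑ i, r j * ‖Y i j‖ ^ 2 : ℝ) : ℂ) := by
    rw [← trace_conjTranspose_mul_self_mul_diagonal]
    calc (Nᴴ * N).trace = (Xᴴ * X * (M * Mᴴ)).trace := by
          simp only [N]
          rw [conjTranspose_mul, Matrix.mul_assoc, trace_mul_comm]
          simp only [Matrix.mul_assoc]
      _ = (F * (Yᴴ * (Eᴴ * E) * Y * (Fᴴ * F) * diagonal (fun j => (r j : ℂ))) * Fᴴ).trace := by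
          rw [hρ]; simp only [X, conjTranspose_mul, conjTranspose_conjTranspose, Matrix.mul_assoc]
      _ = _ := by
          rw [trace_mul_comm, ← Matrix.mul_assoc, hE, hF, Matrix.one_mul, Matrix.mul_one,
            Matrix.mul_one]
  have hMnorm : ∑ j, ∑ i, ‖M i j‖ ^ 2 = 1 := by
    rw [trace_mul_comm, trace_conjTranspose_mul_self_eq_sum] at hM
    exact_mod_cast hM
  have henergy : ∑ k, s k * ‖((V k)ᴴ * N).trace‖ ^ 2 ≤ ∑ j, ∑ i, s' i * ‖Y i j‖ ^ 2 := by
    calc ∑ k, s k * ‖((V k)ᴴ * N).trace‖ ^ 2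
        ≤ ∑ k, s k * ∑ j, ∑ i, ‖(Xᴴ * V k) i j‖ ^ 2 := by
          refine Finset.sum_le_sum fun k _ => mul_le_mul_of_nonneg_left ?_ (hs k)
          have := norm_trace_conjTranspose_mul_sq_le (Xᴴ * V k) M
          rwa [hMnorm, mul_one, conjTranspose_mul, conjTranspose_conjTranspose,
            Matrix.mul_assoc] at this
      _ = ∑ j, ∑ i, s' i * ‖Y i j‖ ^ 2 := by
          rw [← Complex.ofReal_inj]
          calc ((∑ k, s k * ∑ j, ∑ i, ‖(Xᴴ * V k) i j‖ ^ 2 : ℝ) : ℂ)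
              = ∑ k, (s k : ℂ) * ((Xᴴ * V k)ᴴ * (Xᴴ * V k)).trace := by
                simp only [trace_conjTranspose_mul_self_eq_sum]
                push_cast
                rfl
            _ = (Xᴴ * (∑ k, (s k : ℂ) • (V k * (V k)ᴴ)) * X).trace := by
                rw [Finset.mul_sum, Finset.sum_mul, trace_sum]
                refine Finset.sum_congr rfl fun k _ => ?_
                rw [trace_mul_comm, conjTranspose_mul Xᴴ, conjTranspose_conjTranspose,
                  Matrix.mul_smul, Matrix.smul_mul, trace_smul, smul_eq_mul]
                simp only [Matrix.mul_assoc]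
            _ = (F * (Yᴴ * (Eᴴ * E) * diagonal (fun i => (s' i : ℂ)) * (Eᴴ * E) * Y) *
                  Fᴴ).trace := by
                rw [hσ]
                simp only [X, conjTranspose_mul, conjTranspose_conjTranspose, Matrix.mul_assoc]
            _ = (Yᴴ * diagonal (fun i => (s' i : ℂ)) * Y).trace := by
                rw [trace_mul_comm, ← Matrix.mul_assoc, hE, hF, Matrix.one_mul, Matrix.mul_one,
                  Matrix.mul_one]
            _ = _ := by
                push_cast
                simp only [trace, diag_apply, Matrix.mul_apply (M := _ * _), mul_diagonal]
                refine Finset.sum_congr rfl fun j _ => Finset.sum_congr rfl fun i _ => ?_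
                rw [← Complex.conj_mul']
                simp
                ring
  have hYQ : t * (∑ j, ∑ i, r j * ‖Y i j‖ ^ 2) + ∑ j, ∑ i, s' i * ‖Y i j‖ ^ 2 = Q := by
    simp only [hQ, Finset.mul_sum, ← Finset.sum_add_distrib]
    refine Finset.sum_congr rfl fun j _ => Finset.sum_congr rfl fun i _ => ?_
    simp only [Y, of_apply, norm_mul, Complex.norm_real, Real.norm_eq_abs, mul_pow, sq_abs]
    by_cases h0 : s' i + t * r j = 0
    · simp [h0]
    · field_simp
      ring
  have hpt : ∀ k, 2 * (star ((V k)ᴴ * N).trace * ((V k)ᴴ * M).trace).re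
      - (s k + t) * ‖((V k)ᴴ * N).trace‖ ^ 2 ≤ ‖((V k)ᴴ * M).trace‖ ^ 2 / (s k + t) := by
    intro k
    have hp : 0 < s k + t := add_pos_of_nonneg_of_pos (hs k) ht
    have h1 : (star ((V k)ᴴ * N).trace * ((V k)ᴴ * M).trace).re ≤
        ‖((V k)ᴴ * N).trace‖ * ‖((V k)ᴴ * M).trace‖ := by
      refine (Complex.re_le_norm _).trans_eq ?_
      rw [norm_mul, norm_star]
    rw [le_div_iff₀ hp]
    nlinarith [sq_nonneg ((s k + t) * ‖((V k)ᴴ * N).trace‖ - ‖((V k)ᴴ * M).trace‖)]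
  have hsumcross : ∑ k, (star ((V k)ᴴ * N).trace * ((V k)ᴴ * M).trace).re = Q := by
    rw [← Complex.re_sum, hV, hcross, Complex.ofReal_re]
  have hsumnorm : ∑ k, ‖((V k)ᴴ * N).trace‖ ^ 2 = ∑ j, ∑ i, r j * ‖Y i j‖ ^ 2 := by
    rw [← Complex.ofReal_inj, ← hnorm, ← hV]
    push_cast
    exact Finset.sum_congr rfl fun k _ => (Complex.conj_mul' _).symm
  have hfin := Finset.sum_le_sum fun k (_ : k ∈ Finset.univ) => hpt k
  rw [Finset.sum_sub_distrib, ← Finset.mul_sum, hsumcross] at hfin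
  simp only [add_mul, Finset.sum_add_distrib] at hfin
  rw [← Finset.mul_sum, hsumnorm] at hfin
  linarith

open Matrix in
/-- Monotonicity of the relative entropy under partial trace, for a pure first argument `M`
(viewed as a matrix) and a second argument with eigenvectors `V k` and eigenvalues `s k`. -/
theorem relativeEntropy_partialTrace_le {A B K : Type*} [Fintype A] [DecidableEq A] [Fintype B]
    [Fintype K] (V : K → Matrix A B ℂ) (M : Matrix A B ℂ) (s : K → ℝ) (s' r : A → ℝ)
    (E F : Matrix A A ℂ) (hs : ∀ k, 0 ≤ s k) (hs' : ∀ i, 0 ≤ s' i) (hr : ∀ j, 0 ≤ r j)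
    (hE : Eᴴ * E = 1) (hF : Fᴴ * F = 1)
    (hV : ∀ N N' : Matrix A B ℂ,
      ∑ k, star ((V k)ᴴ * N).trace * ((V k)ᴴ * N').trace = (Nᴴ * N').trace)
    (hσ : ∑ k, (s k : ℂ) • (V k * (V k)ᴴ) = E * diagonal (fun i => (s' i : ℂ)) * Eᴴ)
    (hρ : M * Mᴴ = F * diagonal (fun j => (r j : ℂ)) * Fᴴ) (hM : (M * Mᴴ).trace = 1)
    (hsupp : ∀ k, s k = 0 → ‖((V k)ᴴ * M).trace‖ ^ 2 = 0)
    (hsupp' : ∀ i, s' i = 0 → ((Eᴴ * (M * Mᴴ) * E) i i).re = 0) :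
    ∑ k, ‖((V k)ᴴ * M).trace‖ ^ 2 * Real.log (s k) ≤
      ∑ i, ((Eᴴ * (M * Mᴴ) * E) i i).re * Real.log (s' i) - ∑ j, r j * Real.log (r j) := by
  set G := Eᴴ * F with hG
  have hrow : ∀ i, ((Eᴴ * (M * Mᴴ) * E) i i).re = ∑ j, r j * ‖G i j‖ ^ 2 := by
    intro i
    have h1 : Eᴴ * (M * Mᴴ) * E = G * diagonal (fun j => (r j : ℂ)) * Gᴴ := by
      rw [hρ, hG, conjTranspose_mul, conjTranspose_conjTranspose]
      simp only [Matrix.mul_assoc]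
    rw [h1, Matrix.mul_apply, Complex.re_sum]
    refine Finset.sum_congr rfl fun j _ => ?_
    rw [mul_diagonal, conjTranspose_apply, mul_right_comm, Complex.star_def, Complex.mul_conj',
      ← Complex.ofReal_pow, ← Complex.ofReal_mul, Complex.ofReal_re, mul_comm]
  have hcol : ∀ j, ∑ i, ‖G i j‖ ^ 2 = 1 := by
    intro j
    have hGG : Gᴴ * G = 1 := by
      rw [hG, conjTranspose_mul, conjTranspose_conjTranspose, Matrix.mul_assoc,
        ← Matrix.mul_assoc E, mul_eq_one_comm.1 hE, Matrix.one_mul, hF]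
    have := congr_fun (congr_fun hGG j) j
    simp only [Matrix.mul_apply, conjTranspose_apply, Complex.star_def, Complex.conj_mul',
      one_apply_eq] at this
    exact_mod_cast this
  have hrsum : ∑ j, r j = 1 := by
    rw [hρ, trace_mul_comm, ← Matrix.mul_assoc, hF, Matrix.one_mul, trace_diagonal] at hM
    exact_mod_cast hM
  have hwsum : ∑ k, ‖((V k)ᴴ * M).trace‖ ^ 2 = 1 := by
    have := hV M M
    rw [trace_mul_comm Mᴴ, hM] at this
    simp only [Complex.star_def, Complex.conj_mul'] at this
    exact_mod_cast this
  have hvzero : ∀ i j, s' i = 0 → r j * ‖G i j‖ ^ 2 = 0 := by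
    intro i j h0
    have h1 := hsupp' i h0
    rw [hrow, Finset.sum_eq_zero_iff_of_nonneg fun j _ => mul_nonneg (hr j) (sq_nonneg _)] at h1
    exact h1 j (Finset.mem_univ j)
  have key := sum_mul_log_le_of_resolvent_le (fun k => ‖((V k)ᴴ * M).trace‖ ^ 2) s
    (fun p : A × A => r p.1 * ‖G p.2 p.1‖ ^ 2) (fun p => s' p.2 / r p.1) hs
    (fun p => div_nonneg (hs' _) (hr _)) hsupp ?_ ?_ ?_
  · refine key.trans_eq ?_
    have hterm : ∀ p : A × A, r p.1 * ‖G p.2 p.1‖ ^ 2 * Real.log (s' p.2 / r p.1) =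
        r p.1 * ‖G p.2 p.1‖ ^ 2 * Real.log (s' p.2) -
          r p.1 * Real.log (r p.1) * ‖G p.2 p.1‖ ^ 2 := by
      intro p
      by_cases h1 : r p.1 = 0
      · simp [h1]
      by_cases h2 : s' p.2 = 0
      · have h3 := (mul_eq_zero.1 (hvzero p.2 p.1 h2)).resolve_left h1
        simp [h3]
      rw [Real.log_div h2 h1]
      ring
    simp only [hterm, Finset.sum_sub_distrib]
    congr 1
    · rw [Fintype.sum_prod_type_right]
      simp only [hrow, Finset.sum_mul]
    · rw [Fintype.sum_prod_type]
      simp only [← Finset.mul_sum, hcol, mul_one]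
  · intro p hp
    rcases div_eq_zero_iff.1 hp with h | h
    · exact hvzero _ _ h
    · simp [h]
  · rw [hwsum, Fintype.sum_prod_type]
    simp only [← Finset.mul_sum, hcol, mul_one, hrsum]
  · intro t ht
    refine le_trans (le_of_eq ?_)
      (resolvent_partialTrace_le V M s s' r E F hs hE hF hV hσ hρ hM ht)
    rw [Fintype.sum_prod_type]
    refine Finset.sum_congr rfl fun j _ => Finset.sum_congr rfl fun i _ => ?_
    rcases (hr j).eq_or_lt with h | h
    · simp [← h]
    · have := hs' i
      have h2 : 0 < s' i + t * r j := by positivity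
      dsimp only
      rw [← hG]
      field_simp

section PiKron

variable {κ : Type*} [Fintype κ] {C : κ → Type*}

/-- The tensor product of a family of square matrices. -/
def piKron (M : ∀ i, Matrix (C i) (C i) ℂ) : Matrix (∀ i, C i) (∀ i, C i) ℂ :=
  Matrix.of fun x y => ∏ i, M i (x i) (y i)

theorem sum_pi_prod [DecidableEq κ] [∀ i, Fintype (C i)] (f : ∀ i, C i → ℂ) :
    ∑ c : ∀ i, C i, ∏ i, f i (c i) = ∏ i, ∑ a, f i a := by
  rw [Finset.prod_univ_sum, Fintype.piFinset_univ]

theorem piKron_mul [DecidableEq κ] [∀ i, Fintype (C i)] (M N : ∀ i, Matrix (C i) (C i) ℂ) :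
    piKron M * piKron N = piKron fun i => M i * N i := by
  ext x y
  simp only [piKron, Matrix.mul_apply, Matrix.of_apply, ← Finset.prod_mul_distrib]
  exact sum_pi_prod fun i a => M i (x i) a * N i a (y i)

theorem piKron_conjTranspose (M : ∀ i, Matrix (C i) (C i) ℂ) :
    (piKron M).conjTranspose = piKron fun i => (M i).conjTranspose := by
  ext x y
  simp [piKron]

theorem piKron_diagonal [∀ i, DecidableEq (C i)] (d : ∀ i, C i → ℂ) :
    piKron (fun i => Matrix.diagonal (d i)) = Matrix.diagonal fun c => ∏ i, d i (c i) := by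
  ext x y
  rw [piKron, Matrix.of_apply, Matrix.diagonal_apply]
  split_ifs with h
  · simp [h]
  · obtain ⟨i, hi⟩ := Function.ne_iff.1 h
    exact Finset.prod_eq_zero (Finset.mem_univ i) (Matrix.diagonal_apply_ne _ hi)

theorem piKron_one [∀ i, DecidableEq (C i)] :
    piKron (fun i => (1 : Matrix (C i) (C i) ℂ)) = 1 := by
  simpa using piKron_diagonal fun i (_ : C i) => (1 : ℂ)

theorem piKron_conjTranspose_mul_self [DecidableEq κ] [∀ i, Fintype (C i)]
    [∀ i, DecidableEq (C i)] {U : ∀ i, Matrix (C i) (C i) ℂ}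
    (hU : ∀ i, (U i).conjTranspose * U i = 1) : (piKron U).conjTranspose * piKron U = 1 := by
  rw [piKron_conjTranspose, piKron_mul]
  simp only [hU, piKron_one]

/-- The reduced matrix on a single tensor factor. -/
def margin [DecidableEq κ] [∀ i, Fintype (C i)] [∀ i, DecidableEq (C i)] (k : κ)
    (R : Matrix (∀ i, C i) (∀ i, C i) ℂ) :
    Matrix (C k) (C k) ℂ :=
  Matrix.of fun x y => ∑ c : ∀ i, C i, if c k = x then R c (Function.update c k y) else 0

theorem piKron_update_one [DecidableEq κ] [∀ i, DecidableEq (C i)] (k : κ)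
    (X : Matrix (C k) (C k) ℂ) (c c' : ∀ i, C i) :
    piKron (Function.update (fun i => (1 : Matrix (C i) (C i) ℂ)) k X) c c' =
      if c = Function.update c' k (c k) then X (c k) (c' k) else 0 := by
  rw [piKron, Matrix.of_apply, ← Finset.mul_prod_erase _ _ (Finset.mem_univ k),
    Function.update_self]
  split_ifs with h
  · rw [Finset.prod_eq_one, mul_one]
    intro i hi
    have hik := Finset.ne_of_mem_erase hi
    have h2 : c i = c' i := by rw [h, Function.update_of_ne hik]
    rw [Function.update_of_ne hik, h2, Matrix.one_apply_eq]
  · rw [Function.eq_update_iff] at h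
    push Not at h
    obtain ⟨i, hik, hi⟩ := h rfl
    rw [Finset.prod_eq_zero (i := i) (by simp [hik]), mul_zero]
    rw [Function.update_of_ne hik, Matrix.one_apply_ne hi]

theorem trace_mul_piKron_update_one [DecidableEq κ] [∀ i, Fintype (C i)]
    [∀ i, DecidableEq (C i)] (k : κ) (R : Matrix (∀ i, C i) (∀ i, C i) ℂ)
    (X : Matrix (C k) (C k) ℂ) :
    (R * piKron (Function.update (fun i => (1 : Matrix (C i) (C i) ℂ)) k X)).trace =
      (margin k R * X).trace := by
  have h : ∀ c : ∀ i, C i,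
      ∑ c', R c c' * piKron (Function.update (fun i => (1 : Matrix (C i) (C i) ℂ)) k X) c' c =
        ∑ y, R c (Function.update c k y) * X y (c k) := by
    intro c
    simp only [piKron_update_one, mul_ite, mul_zero]
    rw [← Finset.sum_filter]
    refine Finset.sum_bij' (fun c' _ => c' k) (fun y _ => Function.update c k y) ?_ ?_ ?_ ?_ ?_
    · simp
    · simp
    · intro c' hc'
      exact (Finset.mem_filter.1 hc').2.symm
    · simp
    · intro c' hc'
      rw [← (Finset.mem_filter.1 hc').2]
  have h' : (margin k R * X).trace =
      ∑ c : ∀ i, C i, ∑ y, ∑ x, if c k = x then R c (Function.update c k y) * X y x else 0 := by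
    simp only [Matrix.trace, Matrix.diag_apply, Matrix.mul_apply, margin, Matrix.of_apply,
      Finset.sum_mul, ite_mul, zero_mul]
    rw [Finset.sum_comm]
    refine (Finset.sum_congr rfl fun y _ => Finset.sum_comm).trans ?_
    exact Finset.sum_comm
  rw [h']
  simp only [Matrix.trace, Matrix.diag_apply, Matrix.mul_apply, h, Finset.sum_ite_eq,
    Finset.mem_univ, if_true]

/-- The marginals of the outcome distribution of a product measurement. -/
theorem sum_diag_piKron_conj [DecidableEq κ] [∀ i, Fintype (C i)] [∀ i, DecidableEq (C i)] (k : κ)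
    (R : Matrix (∀ i, C i) (∀ i, C i) ℂ) {U : ∀ i, Matrix (C i) (C i) ℂ}
    (hU : ∀ i, U i * (U i).conjTranspose = 1) (a : C k) :
    (∑ c : ∀ i, C i,
      if c k = a then ((piKron U).conjTranspose * R * piKron U) c c else 0) =
      ((U k).conjTranspose * margin k R * U k) a a := by
  set P := Function.update (fun i => (1 : Matrix (C i) (C i) ℂ)) k (Matrix.single a a 1) with hP
  have h1 : piKron U * piKron P * (piKron U).conjTranspose =
      piKron (Function.update (fun i => (1 : Matrix (C i) (C i) ℂ)) k
        (U k * Matrix.single a a 1 * (U k).conjTranspose)) := by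
    rw [piKron_conjTranspose, piKron_mul, piKron_mul]
    congr 1
    ext1 i
    by_cases hi : i = k
    · subst hi; simp [hP]
    · simp [hP, hi, hU]
  have h2 : (∑ c : ∀ i, C i,
      if c k = a then ((piKron U).conjTranspose * R * piKron U) c c else 0) =
      ((piKron U).conjTranspose * R * piKron U * piKron P).trace := by
    rw [hP, trace_mul_piKron_update_one, Matrix.trace_mul_single, MulOpposite.op_one, one_smul]
    simp only [margin, Matrix.of_apply]
    refine Finset.sum_congr rfl fun c _ => ?_
    split_ifs with h
    · rw [← h, Function.update_eq_self]
    · rfl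
  rw [h2, Matrix.mul_assoc, Matrix.mul_assoc, Matrix.trace_mul_comm, Matrix.mul_assoc, h1,
    trace_mul_piKron_update_one, ← Matrix.mul_assoc, Matrix.trace_mul_comm, ← Matrix.mul_assoc,
    ← Matrix.mul_assoc, Matrix.trace_mul_single,
    MulOpposite.op_one, one_smul]

/-- The outcome distribution of a product measurement is supported where all its marginals are. -/
theorem eq_zero_of_prod_marginal_eq_zero [DecidableEq κ] [∀ i, Fintype (C i)]
    [∀ i, DecidableEq (C i)] (w : (∀ i, C i) → ℝ) (hw : ∀ c, 0 ≤ w c) (s : ∀ i, C i → ℝ)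
    (hs : ∀ k a, (∑ c, if c k = a then w c else 0) = s k a) (c : ∀ i, C i)
    (hc : ∏ i, s i (c i) = 0) : w c = 0 := by
  obtain ⟨k, -, hk⟩ := Finset.prod_eq_zero_iff.1 hc
  rw [← hs, Finset.sum_eq_zero_iff_of_nonneg fun c _ => by split_ifs <;> simp [hw]] at hk
  simpa using hk c (Finset.mem_univ c)

/-- The cross entropy with a product of marginals is the sum of the marginal entropies. -/
theorem sum_mul_log_prod_marginal [DecidableEq κ] [∀ i, Fintype (C i)] [∀ i, DecidableEq (C i)]
    (w : (∀ i, C i) → ℝ) (hw : ∀ c, 0 ≤ w c) (s : ∀ i, C i → ℝ)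
    (hs : ∀ k a, (∑ c, if c k = a then w c else 0) = s k a) :
    ∑ c, w c * Real.log (∏ i, s i (c i)) = -∑ i, ∑ a, Real.negMulLog (s i a) := by
  have h1 : ∀ c, w c * Real.log (∏ i, s i (c i)) = ∑ i, w c * Real.log (s i (c i)) := by
    intro c
    by_cases hc : ∏ i, s i (c i) = 0
    · simp [eq_zero_of_prod_marginal_eq_zero w hw s hs c hc]
    · rw [Real.log_prod (fun i hi => Finset.prod_ne_zero_iff.1 hc i hi), Finset.mul_sum]
  simp only [h1]
  rw [Finset.sum_comm, ← Finset.sum_neg_distrib]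
  refine Finset.sum_congr rfl fun k _ => ?_
  simp only [Real.negMulLog, neg_mul, Finset.sum_neg_distrib, neg_neg]
  simp only [← hs, Finset.sum_mul, ite_mul, zero_mul]
  rw [Finset.sum_comm]
  simp

end PiKron

/-- Grouping each system with its ancilla. -/
def pairSumEquiv {κ : Type} (A B : κ → Type) :
    (∀ i, A i × B i) ≃ (∀ i : κ ⊕ κ, Sum.elim A B i) where
  toFun c := mergeSum (fun i => (c i).1) fun i => (c i).2
  invFun f i := (f (Sum.inl i), f (Sum.inr i))
  left_inv c := rfl
  right_inv f := by ext (i | i) <;> rfl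

@[simp]
theorem pairSumEquiv_inl {κ : Type} (A B : κ → Type) (c : ∀ i, A i × B i) (i : κ) :
    pairSumEquiv A B c (Sum.inl i) = (c i).1 := rfl

@[simp]
theorem pairSumEquiv_inr {κ : Type} (A B : κ → Type) (c : ∀ i, A i × B i) (i : κ) :
    pairSumEquiv A B c (Sum.inr i) = (c i).2 := rfl

section Reduction

open Matrix

variable {κ : Type} [Fintype κ] [DecidableEq κ]

theorem Matrix.IsHermitian.margin {C : κ → Type} [∀ i, Fintype (C i)] [∀ i, DecidableEq (C i)]
    {R : Matrix (∀ i, C i) (∀ i, C i) ℂ} (hR : R.IsHermitian) (k : κ) :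
    (margin k R).IsHermitian := by
  have entry : ∀ x y, _root_.margin k R x y =
      (R * piKron (Function.update (fun i => (1 : Matrix (C i) (C i) ℂ)) k
        (single y x 1))).trace := by
    intro x y
    rw [trace_mul_piKron_update_one, trace_mul_single, MulOpposite.op_one, one_smul]
  ext x y
  rw [conjTranspose_apply, entry, entry, ← trace_conjTranspose, conjTranspose_mul, hR.eq,
    piKron_conjTranspose, trace_mul_comm]
  congr 3
  ext1 i
  by_cases hi : i = k
  · subst hi; simp
  · simp [hi]

/-- Measuring in the product of the eigenbases of the reductions, the marginal distributions are
given by the spectra of the reductions. -/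
theorem sum_diag_eigenvectorUnitary_conj {C : κ → Type} [∀ i, Fintype (C i)]
    [∀ i, DecidableEq (C i)] (R : Matrix (∀ i, C i) (∀ i, C i) ℂ)
    (h : ∀ k, (margin k R).IsHermitian) (k : κ) (a : C k) :
    (∑ c : ∀ i, C i, if c k = a then
      (((piKron fun i => ((h i).eigenvectorUnitary : Matrix (C i) (C i) ℂ))ᴴ * R *
        piKron fun i => ((h i).eigenvectorUnitary : Matrix (C i) (C i) ℂ)) c c).re else 0) =
      (h k).eigenvalues a := by
  have h1 := sum_diag_piKron_conj k R
    (U := fun i => ((h i).eigenvectorUnitary : Matrix (C i) (C i) ℂ))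
    (fun i => Unitary.coe_mul_star_self (h i).eigenvectorUnitary) a
  have hU : ((h k).eigenvectorUnitary : Matrix (C k) (C k) ℂ)ᴴ * (h k).eigenvectorUnitary = 1 :=
    Unitary.coe_star_mul_self (h k).eigenvectorUnitary
  have h2 : ((h k).eigenvectorUnitary : Matrix (C k) (C k) ℂ)ᴴ * margin k R *
      (h k).eigenvectorUnitary = diagonal (fun i => ((h k).eigenvalues i : ℂ)) := by
    refine (congrArg (fun X => ((h k).eigenvectorUnitary : Matrix (C k) (C k) ℂ)ᴴ * X *
      (h k).eigenvectorUnitary) (h k).eq_eigenvectorUnitary_mul).trans ?_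
    rw [Matrix.mul_assoc, Matrix.mul_assoc, hU, Matrix.mul_one, ← Matrix.mul_assoc, hU,
      Matrix.one_mul]
  rw [h2, diagonal_apply_eq] at h1
  have h3 := congrArg Complex.re h1
  rw [Complex.re_sum, Complex.ofReal_re] at h3
  rw [← h3]
  refine Finset.sum_congr rfl fun c _ => ?_
  split_ifs <;> rfl

/-- Spectral decomposition of a tensor product of Hermitian matrices. -/
theorem piKron_eigenvectorUnitary {C : κ → Type} [∀ i, Fintype (C i)] [∀ i, DecidableEq (C i)]
    {N : ∀ i, Matrix (C i) (C i) ℂ} (h : ∀ i, (N i).IsHermitian) :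
    piKron (fun i => ((h i).eigenvectorUnitary : Matrix (C i) (C i) ℂ)) *
      diagonal (fun c => ((∏ i, (h i).eigenvalues (c i) : ℝ) : ℂ)) *
      (piKron fun i => ((h i).eigenvectorUnitary : Matrix (C i) (C i) ℂ))ᴴ = piKron N := by
  have hd := piKron_diagonal fun i a => ((h i).eigenvalues a : ℂ)
  push_cast
  rw [← hd, piKron_conjTranspose, piKron_mul, piKron_mul]
  exact congrArg piKron (funext fun i => (h i).eq_eigenvectorUnitary_mul.symm)

variable {A B : κ → Type} [∀ i, Fintype (A i)] [∀ i, Fintype (B i)]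

/-- Grouping the systems `A i` and `B i` in pairs. -/
def piProdEquiv (A B : κ → Type) : (∀ i, A i × B i) ≃ (∀ i, A i) × (∀ i, B i) where
  toFun x := (fun i => (x i).1, fun i => (x i).2)
  invFun p := fun i => (p.1 i, p.2 i)

/-- The vector on the paired systems given by a matrix between the `A` and the `B` systems. -/
def pairVec (N : Matrix (∀ i, A i) (∀ i, B i) ℂ) (x : ∀ i, A i × B i) : ℂ :=
  N (fun i => (x i).1) (fun i => (x i).2)

/-- Reshaping a vector on the paired systems to a matrix between the `A` and the `B` systems. -/
def unpair (v : (∀ i, A i × B i) → ℂ) : Matrix (∀ i, A i) (∀ i, B i) ℂ :=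
  Matrix.of fun a b => v fun i => (a i, b i)

theorem sum_pairVec (f : (∀ i, A i) → (∀ i, B i) → ℂ) :
    ∑ b, ∑ a, f a b = ∑ x : ∀ i, A i × B i, f (fun i => (x i).1) (fun i => (x i).2) := by
  rw [← Fintype.sum_prod_type_right' f]
  exact ((piProdEquiv A B).sum_comp fun p => f p.1 p.2).symm

theorem trace_conjTranspose_mul_eq_pairVec (N N' : Matrix (∀ i, A i) (∀ i, B i) ℂ) :
    (Nᴴ * N').trace = star (pairVec N) ⬝ᵥ pairVec N' := by
  simp only [trace, diag_apply, Matrix.mul_apply, conjTranspose_apply]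
  exact sum_pairVec fun a b => star (N a b) * N' a b

theorem trace_unpair_conjTranspose_mul (U : Matrix (∀ i, A i × B i) (∀ i, A i × B i) ℂ)
    (N : Matrix (∀ i, A i) (∀ i, B i) ℂ) (c : ∀ i, A i × B i) :
    ((unpair fun x => U x c)ᴴ * N).trace = (Uᴴ *ᵥ pairVec N) c := by
  rw [trace_conjTranspose_mul_eq_pairVec]
  rfl

theorem isHermitian_vecState {ι : Type} (v : ι → ℂ) : (vecState v).IsHermitian := by
  ext x y
  simp [vecState, mul_comm]

theorem conj_vecState_diag {ι : Type} [Fintype ι] (U : Matrix ι ι ℂ) (v : ι → ℂ) (c : ι) :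
    ((Uᴴ * vecState v * U) c c).re = ‖(Uᴴ *ᵥ v) c‖ ^ 2 := by
  have h1 : vecState v = vecMulVec v (star v) := rfl
  have h2 : star v ᵥ* U = star (Uᴴ *ᵥ v) := by rw [star_mulVec, conjTranspose_conjTranspose]
  rw [h1, mul_vecMulVec, vecMulVec_mul, h2, vecMulVec_apply, Pi.star_apply, Complex.star_def,
    Complex.mul_conj', ← Complex.ofReal_pow, Complex.ofReal_re]

/-- Partial traces can be taken successively. -/
theorem sum_margin_vecState_pairVec [∀ i, DecidableEq (A i)] [∀ i, DecidableEq (B i)]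
    (M : Matrix (∀ i, A i) (∀ i, B i) ℂ) (k : κ) (x y : A k) :
    ∑ b, margin k (vecState (pairVec M)) (x, b) (y, b) = margin k (M * Mᴴ) x y := by
  have h1 : margin k (M * Mᴴ) x y = ∑ b, ∑ a : ∀ i, A i,
      if a k = x then M a b * star (M (Function.update a k y) b) else 0 := by
    simp only [margin, of_apply, Matrix.mul_apply, conjTranspose_apply]
    rw [Finset.sum_comm]
    refine Finset.sum_congr rfl fun a _ => ?_
    split_ifs <;> simp
  rw [h1, sum_pairVec fun a b => if a k = x then M a b * star (M (Function.update a k y) b) else 0]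
  simp only [margin, of_apply]
  rw [Finset.sum_comm]
  refine Finset.sum_congr rfl fun c _ => ?_
  by_cases hx : (c k).1 = x
  · rw [if_pos hx, Finset.sum_eq_single (c k).2, if_pos (by rw [← hx])]
    · simp only [vecState, pairVec, of_apply]
      congr 4
      · ext i
        by_cases hi : i = k
        · subst hi; simp
        · simp [hi]
      · ext i
        by_cases hi : i = k
        · subst hi; simp
        · simp [hi]
    · intro b _ hb
      rw [if_neg]
      intro h
      exact hb (by rw [h])
    · simp
  · rw [if_neg hx]
    refine Finset.sum_eq_zero fun b _ => if_neg fun h => hx (by rw [h])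

/-- For a pure state, the sum of the entropies of the enlarged parties bounds the mutual information
of the original ones. -/
theorem sum_matEntropy_margin_sub_le [∀ i, DecidableEq (A i)] [∀ i, DecidableEq (B i)]
    (M : Matrix (∀ i, A i) (∀ i, B i) ℂ)
    (hM : (M * Mᴴ).trace = 1) :
    ∑ i, matEntropy (margin i (M * Mᴴ)) - matEntropy (M * Mᴴ) ≤
      ∑ i, matEntropy (margin i (vecState (pairVec M))) := by
  have hρ : (M * Mᴴ).IsHermitian := isHermitian_mul_conjTranspose_self M
  have hpsd : (M * Mᴴ).PosSemidef := posSemidef_self_mul_conjTranspose M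
  have hA : ∀ k, (margin k (M * Mᴴ)).IsHermitian := hρ.margin
  have hAB : ∀ k, (margin k (vecState (pairVec M))).IsHermitian :=
    (isHermitian_vecState _).margin
  set E : Matrix (∀ i, A i) (∀ i, A i) ℂ :=
    piKron fun i => ((hA i).eigenvectorUnitary : Matrix (A i) (A i) ℂ) with hE
  set U : Matrix (∀ i, A i × B i) (∀ i, A i × B i) ℂ :=
    piKron fun i => ((hAB i).eigenvectorUnitary : Matrix (A i × B i) (A i × B i) ℂ) with hU
  have hEE : Eᴴ * E = 1 :=
    piKron_conjTranspose_mul_self fun i => Unitary.coe_star_mul_self (hA i).eigenvectorUnitary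
  have hUU : U * Uᴴ = 1 := mul_eq_one_comm.1 <|
    piKron_conjTranspose_mul_self fun i => Unitary.coe_star_mul_self (hAB i).eigenvectorUnitary
  have hw : ∀ c, 0 ≤ ((Uᴴ * vecState (pairVec M) * U) c c).re := fun c => by
    rw [conj_vecState_diag]; positivity
  have hw' : ∀ c, 0 ≤ ((Eᴴ * (M * Mᴴ) * E) c c).re := fun c =>
    (Complex.le_def.1 ((hpsd.conjTranspose_mul_mul_same E).diag_nonneg (i := c))).1
  have hm := sum_diag_eigenvectorUnitary_conj _ hAB
  have hm' := sum_diag_eigenvectorUnitary_conj _ hA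
  rw [← hU] at hm
  rw [← hE] at hm'
  have hnn : ∀ k a, 0 ≤ (hAB k).eigenvalues a := fun k a => by
    rw [← hm]; exact Finset.sum_nonneg fun c _ => by split_ifs <;> simp [hw]
  have hnn' : ∀ k a, 0 ≤ (hA k).eigenvalues a := fun k a => by
    rw [← hm']; exact Finset.sum_nonneg fun c _ => by split_ifs <;> simp [hw']
  have hwV : ∀ c, ‖((unpair fun x => U x c)ᴴ * M).trace‖ ^ 2 =
      ((Uᴴ * vecState (pairVec M) * U) c c).re := fun c => by
    rw [trace_unpair_conjTranspose_mul, conj_vecState_diag]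
  have key := relativeEntropy_partialTrace_le (fun c => unpair fun x => U x c) M
    (fun c => ∏ i, (hAB i).eigenvalues (c i)) (fun c => ∏ i, (hA i).eigenvalues (c i))
    hρ.eigenvalues E hρ.eigenvectorUnitary
    (fun c => Finset.prod_nonneg fun i _ => hnn i (c i))
    (fun c => Finset.prod_nonneg fun i _ => hnn' i (c i)) hpsd.eigenvalues_nonneg hEE
    (Unitary.coe_star_mul_self hρ.eigenvectorUnitary) ?_ ?_ hρ.eq_eigenvectorUnitary_mul hM ?_
    (eq_zero_of_prod_marginal_eq_zero _ hw' _ hm')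
  · simp only [hwV] at key
    rw [sum_mul_log_prod_marginal _ hw _ hm, sum_mul_log_prod_marginal _ hw' _ hm'] at key
    rw [hρ.matEntropy_eq]
    simp only [(hA _).matEntropy_eq, (hAB _).matEntropy_eq]
    simp only [Real.negMulLog, neg_mul, Finset.sum_neg_distrib, neg_neg] at key ⊢
    linarith
  · intro N N'
    simp only [trace_unpair_conjTranspose_mul]
    change star (Uᴴ *ᵥ pairVec N) ⬝ᵥ (Uᴴ *ᵥ pairVec N') = _
    rw [star_mulVec, conjTranspose_conjTranspose, ← dotProduct_mulVec, mulVec_mulVec, hUU,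
      one_mulVec, trace_conjTranspose_mul_eq_pairVec]
  · rw [hE, piKron_eigenvectorUnitary]
    have hR := piKron_eigenvectorUnitary hAB
    rw [← hU] at hR
    ext a a'
    calc _ = ∑ b : ∀ i, B i, (U * diagonal (fun c : ∀ i, A i × B i =>
            ((∏ i, (hAB i).eigenvalues (c i) : ℝ) : ℂ)) * Uᴴ)
            (fun i => (a i, b i)) (fun i => (a' i, b i)) := by
          simp only [Matrix.sum_apply, Matrix.smul_apply, Matrix.mul_apply (N := Uᴴ),
            Matrix.mul_diagonal, smul_eq_mul, Matrix.mul_apply (M := unpair _), Finset.mul_sum]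
          rw [Finset.sum_comm]
          refine Finset.sum_congr rfl fun b _ => Finset.sum_congr rfl fun c _ => ?_
          simp only [unpair, of_apply, conjTranspose_apply]
          ring
      _ = _ := by
          rw [hR]
          simp only [piKron, of_apply, ← sum_margin_vecState_pairVec]
          exact sum_pi_prod fun i b => margin i (vecState (pairVec M)) (a i, b) (a' i, b)
  · intro c hc
    rw [hwV]
    exact eq_zero_of_prod_marginal_eq_zero _ hw _ hm c hc

theorem isHermitian_reduce {α : κ → Type} [∀ i, Fintype (α i)] (s : Finset κ)
    {R : Matrix (∀ i, α i) (∀ i, α i) ℂ} (hR : R.IsHermitian) : (reduce s R).IsHermitian := by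
  ext f g
  simp only [reduce, conjTranspose_apply, of_apply, star_sum, hR.apply]

theorem reduce_apply_eq_sum {α : κ → Type} [∀ i, Fintype (α i)] [∀ i, DecidableEq (α i)]
    (s : Finset κ) (R : Matrix (∀ i, α i) (∀ i, α i) ℂ) (f g : ∀ i : {j // j ∈ s}, α i.1) :
    reduce s R f g = ∑ c : ∀ i, α i, if (fun i : {j // j ∈ s} => c i.1) = f then
      R c (fun i => if hi : i ∈ s then g ⟨i, hi⟩ else c i) else 0 := by
  rw [← (Equiv.piEquivPiSubtypeProd (· ∈ s) α).symm.sum_comp, Fintype.sum_prod_type,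
    Finset.sum_eq_single f]
  · rw [reduce, of_apply]
    refine Finset.sum_congr rfl fun h _ => ?_
    rw [if_pos (by ext i; simp [Equiv.piEquivPiSubtypeProd])]
    congr 1
    ext i
    by_cases hi : i ∈ s <;> simp [Equiv.piEquivPiSubtypeProd, hi]
  · intro f' _ hf'
    refine Finset.sum_eq_zero fun h _ => if_neg fun hh => hf' ?_
    rw [← hh]
    ext i
    simp [Equiv.piEquivPiSubtypeProd]
  · simp

/-- Assignments on a single system. -/
def singletonPiEquiv (α : κ → Type) (k : κ) :
    (∀ i : {j // j ∈ ({k} : Finset κ)}, α i.1) ≃ α k where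
  toFun f := f ⟨k, Finset.mem_singleton_self k⟩
  invFun x i := (Finset.mem_singleton.1 i.2).symm ▸ x
  left_inv f := by
    ext ⟨i, hi⟩
    obtain rfl := Finset.mem_singleton.1 hi
    rfl
  right_inv x := rfl

theorem reindex_reduce_singleton {α : κ → Type} [∀ i, Fintype (α i)] [∀ i, DecidableEq (α i)]
    (k : κ) (R : Matrix (∀ i, α i) (∀ i, α i) ℂ) :
    reindex (singletonPiEquiv α k) (singletonPiEquiv α k) (reduce {k} R) = margin k R := by
  ext x y
  rw [reindex_apply, submatrix_apply, reduce_apply_eq_sum, margin, of_apply]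
  refine Finset.sum_congr rfl fun c _ => ?_
  simp only [Equiv.eq_symm_apply]
  refine if_congr Iff.rfl (congrArg _ ?_) rfl
  ext i
  by_cases hi : i = k
  · subst hi
    simp [singletonPiEquiv]
  · simp [hi]

theorem matEntropy_reduce_singleton {α : κ → Type} [∀ i, Fintype (α i)] [∀ i, DecidableEq (α i)]
    (k : κ) {R : Matrix (∀ i, α i) (∀ i, α i) ℂ} (hR : R.IsHermitian) :
    matEntropy (reduce {k} R) = matEntropy (margin k R) := by
  rw [← reindex_reduce_singleton, (isHermitian_reduce {k} hR).matEntropy_reindex]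

theorem inl_mem_partyFinset_id {j k : κ} : Sum.inl j ∈ partyFinset (id : κ → κ) k ↔ j = k := by
  simpa [partyFinset] using eq_comm

theorem inr_mem_partyFinset_id {j k : κ} : Sum.inr j ∈ partyFinset (id : κ → κ) k ↔ j = k := by
  simp [partyFinset]

/-- Assignments on a single system together with its ancilla. -/
def partyPiEquiv (A B : κ → Type) (k : κ) :
    (∀ i : {j // j ∈ partyFinset (id : κ → κ) k}, Sum.elim A B i.1) ≃ A k × B k where
  toFun f := (f ⟨Sum.inl k, inl_mem_partyFinset_id.2 rfl⟩,
    f ⟨Sum.inr k, inr_mem_partyFinset_id.2 rfl⟩)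
  invFun x
    | ⟨Sum.inl _, hj⟩ => (inl_mem_partyFinset_id.1 hj).symm ▸ x.1
    | ⟨Sum.inr _, hj⟩ => (inr_mem_partyFinset_id.1 hj).symm ▸ x.2
  left_inv f := by
    ext ⟨i | i, hi⟩
    · obtain rfl := inl_mem_partyFinset_id.1 hi
      rfl
    · obtain rfl := inr_mem_partyFinset_id.1 hi
      rfl
  right_inv x := rfl

theorem reindex_reduce_party [∀ i, DecidableEq (A i)] [∀ i, DecidableEq (B i)] (k : κ)
    (ψ : (∀ i : κ ⊕ κ, Sum.elim A B i) → ℂ) :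
    reindex (partyPiEquiv A B k) (partyPiEquiv A B k)
        (reduce (partyFinset (id : κ → κ) k) (vecState ψ)) =
      margin k (vecState (pairVec (Matrix.of fun a b => ψ (mergeSum a b)))) := by
  ext x y
  rw [reindex_apply, submatrix_apply, reduce_apply_eq_sum, margin, of_apply,
    ← (pairSumEquiv A B).sum_comp]
  refine Finset.sum_congr rfl fun c _ => ?_
  simp only [Equiv.eq_symm_apply]
  refine if_congr Iff.rfl ?_ rfl
  have h : (fun i => if hi : i ∈ partyFinset (id : κ → κ) k then
      (partyPiEquiv A B k).symm y ⟨i, hi⟩ else pairSumEquiv A B c i) =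
      pairSumEquiv A B (Function.update c k y) := by
    ext (i | i)
    · by_cases hi : i = k
      · subst hi
        simp [inl_mem_partyFinset_id, partyPiEquiv]
      · simp [inl_mem_partyFinset_id, hi]
    · by_cases hi : i = k
      · subst hi
        simp [inr_mem_partyFinset_id, partyPiEquiv]
      · simp [inr_mem_partyFinset_id, hi]
  rw [h]
  rfl

theorem matEntropy_reduce_party [∀ i, DecidableEq (A i)] [∀ i, DecidableEq (B i)] (k : κ)
    (ψ : (∀ i : κ ⊕ κ, Sum.elim A B i) → ℂ) :
    matEntropy (reduce (partyFinset (id : κ → κ) k) (vecState ψ)) =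
      matEntropy (margin k (vecState (pairVec (Matrix.of fun a b => ψ (mergeSum a b))))) := by
  rw [← reindex_reduce_party,
    (isHermitian_reduce _ (isHermitian_vecState ψ)).matEntropy_reindex]

open scoped MatrixOrder Matrix.Norms.L2Operator in
/-- Every positive semidefinite matrix has a purification. -/
theorem exists_purifies [∀ i, DecidableEq (A i)] {ρ : Matrix (∀ i, A i) (∀ i, A i) ℂ}
    (hρ : ρ.PosSemidef) :
    ∃ (d : κ → ℕ) (ψ : (∀ i : κ ⊕ κ, Sum.elim A (fun k => Fin (d k)) i) → ℂ),
      Purifies ψ ρ := by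
  obtain ⟨X, hX⟩ := CStarAlgebra.nonneg_iff_eq_star_mul_self.1 hρ.nonneg
  let e : (∀ i, Fin (Fintype.card (A i))) ≃ ∀ i, A i :=
    Equiv.piCongrRight fun i => (Fintype.equivFin (A i)).symm
  refine ⟨fun i => Fintype.card (A i), fun c => Xᴴ (fun i => c (Sum.inl i))
    (e fun i => c (Sum.inr i)), fun f g => ?_⟩
  rw [hX, Matrix.mul_apply, ← e.sum_comp]
  refine Finset.sum_congr rfl fun h _ => ?_
  simp [vecState, mergeSum]

end Reduction

/-- the multipartite entanglement of purification is bounded below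
by the multipartite mutual information. -/
theorem DeltaP_ge_multipartite_MI {n : ℕ} {α : Fin n → Type}
    [∀ i, Fintype (α i)] [∀ i, DecidableEq (α i)]
    (ρ : Matrix (∀ i, α i) (∀ i, α i) ℂ) (hρ : IsDensityMatrix ρ) :
    Imulti ρ ≤ DeltaPart id ρ := by
  refine le_csInf ?_ ?_
  · obtain ⟨d, ψ, h⟩ := exists_purifies hρ.1
    exact ⟨_, d, ψ, h, rfl⟩
  · rintro _ ⟨d, ψ, h, rfl⟩
    have hM : ρ = Matrix.of (fun a b => ψ (mergeSum a b)) *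
        (Matrix.of fun a b => ψ (mergeSum a b)).conjTranspose := by
      ext f g
      rw [← h f g, Matrix.mul_apply]
      rfl
    have key := sum_matEntropy_margin_sub_le (Matrix.of fun a b => ψ (mergeSum a b))
      (hM ▸ hρ.2)
    rw [← hM] at key
    simpa only [Imulti, matEntropy_reduce_singleton _ hρ.1.isHermitian, matEntropy_reduce_party]
      using key
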